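/- arXiv:2006.07947 — 2 statements merged into one kernel-verified Lean document; each statement's English description precedes it below -/
import Mathlib

section
/- Let W be a Coxeter group. The standard language 𝓛 is geodesic: every word v ∈ 𝓛 of length n representing an element g ∈ W satisfies n = ℓ(g). -/
namespace CoxeterPaper

open CoxeterSystem

attribute [local instance] Classical.propDecidable

variable {B : Type} [DecidableEq B] [Fintype B]
variable {W : Type} [Group W] {M : CoxeterMatrix B}

/-- The right descent set `T(g) = {s ∈ S : ℓ(gs) < ℓ(g)}`, as a set of indices. -/
def descentSet (cs : CoxeterSystem M W) (g : W) : Set B :=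
  {i | cs.IsRightDescent g i}

/-- The subgroup `⟨T(g)⟩` generated by the right descent set of `g`. -/
def descSubgroup (cs : CoxeterSystem M W) (g : W) : Subgroup W :=
  Subgroup.closure (cs.simple '' descentSet cs g)

/-- `w(g)`: the longest element of `⟨T(g)⟩` (defined via choice; for `g ≠ 1` the
subgroup `⟨T(g)⟩` is finite and has a unique longest element). -/
noncomputable def wg (cs : CoxeterSystem M W) (g : W) : W :=
  if h : ∃ w₀ ∈ descSubgroup cs g, ∀ u ∈ descSubgroup cs g, cs.length u ≤ cs.length w₀
  then h.choose else 1

/-- `Π(g) = g · w(g)`. -/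
noncomputable def PiMap (cs : CoxeterSystem M W) (g : W) : W := g * wg cs g

/-- The standard language `𝓛 ⊆ S*`: the empty word is in `𝓛` (and it is the only word of `𝓛`
representing the identity); a word `v` of length `n` representing `g ≠ 1` is in `𝓛` iff,
setting `k = ℓ(w(g))`, the prefix `v(n-k)` is in `𝓛` and `v(n-k+1, n)` represents `w(g)`. -/
inductive StdLang (cs : CoxeterSystem M W) : List B → Prop
  | nil : StdLang cs []
  | step (v : List B) (hne : cs.wordProd v ≠ 1)
      (hpre : StdLang cs (v.take (v.length - cs.length (wg cs (cs.wordProd v)))))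
      (hsuf : cs.wordProd (v.drop (v.length - cs.length (wg cs (cs.wordProd v))))
        = wg cs (cs.wordProd v)) : StdLang cs v

/-- A Coxeter group is 2-dimensional if every triple of distinct generators
generates an infinite subgroup. -/
def TwoDimensional (cs : CoxeterSystem M W) : Prop :=
  ∀ i j k : B, i ≠ j → i ≠ k → j ≠ k →
    Infinite (Subgroup.closure {cs.simple i, cs.simple j, cs.simple k} : Subgroup W)

/-- The wall of the reflection `ρ` separates `g` and `h`. -/
def Separates (cs : CoxeterSystem M W) (ρ g h : W) : Prop :=
  Xor' (cs.length (ρ * g) < cs.length g) (cs.length (ρ * h) < cs.length h)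

/-- `h` is adjacent to the wall of the reflection `ρ`. -/
def AdjacentWall (cs : CoxeterSystem M W) (ρ h : W) : Prop :=
  ∃ i : B, ρ = h * cs.simple i * h⁻¹

/-- The wall of `ρ'` separates `g` from the wall of `ρ`. -/
def SeparatesFromWall (cs : CoxeterSystem M W) (ρ' g ρ : W) : Prop :=
  ∀ h : W, AdjacentWall cs ρ h → Separates cs ρ' g h

/-- `𝓦(g)`: the set of walls (identified with their reflections) separating `g` from the
identity and not separated from `g` by any other wall. -/
def WallsNear (cs : CoxeterSystem M W) (g : W) : Set W :=
  {ρ | cs.IsReflection ρ ∧ cs.length (ρ * g) < cs.length g ∧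
    ∀ ρ' : W, cs.IsReflection ρ' → ρ' ≠ ρ → ¬ SeparatesFromWall cs ρ' g ρ}

section Exchange

omit [DecidableEq B] [Fintype B]

/-- The action of a simple reflection on `W × ℤ/2`: conjugation on the first factor, with the
second factor flipped exactly at the simple reflection itself. -/
noncomputable def signedConj (cs : CoxeterSystem M W) (i : B) : Function.End (W × ZMod 2) :=
  fun p => (cs.simple i * p.1 * cs.simple i, p.2 + if p.1 = cs.simple i then 1 else 0)

theorem signedConj_mul_pow_apply (cs : CoxeterSystem M W) (i j : B) (n : ℕ) (p : W × ZMod 2) :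
    ((signedConj cs i * signedConj cs j) ^ n) p =
      ((cs.simple i * cs.simple j) ^ n * p.1 * ((cs.simple i * cs.simple j) ^ n)⁻¹,
        p.2 + ∑ k ∈ Finset.range (2 * n),
          if p.1 = cs.simple j * (cs.simple i * cs.simple j) ^ k then 1 else 0) := by
  induction n with
  | zero => simp [Function.End.one_def]
  | succ n ih =>
    have hstep : ((signedConj cs i * signedConj cs j) ^ (n + 1)) p =
        signedConj cs i (signedConj cs j (((signedConj cs i * signedConj cs j) ^ n) p)) := by
      rw [pow_succ']; rfl
    rw [hstep, ih, show 2 * (n + 1) = 2 * n + 1 + 1 by ring, Finset.sum_range_succ,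
      Finset.sum_range_succ]
    set c := cs.simple i * cs.simple j with hc
    have hcj : ∀ k : ℕ, cs.simple j * c ^ k * cs.simple j = (c ^ k)⁻¹ := by
      intro k
      have h := conj_pow (i := k) (a := cs.simple j) (b := c)
      rw [cs.inv_simple] at h
      rw [← h, ← inv_pow, hc]
      simp [mul_assoc]
    have hck : ∀ k : ℕ, (c ^ k)⁻¹ * cs.simple j = cs.simple j * c ^ k := by
      intro k
      rw [← hcj k]; simp
    have h₁ : c ^ n * p.1 * (c ^ n)⁻¹ = cs.simple j ↔ p.1 = cs.simple j * c ^ (2 * n) := by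
      rw [two_mul, pow_add, ← mul_assoc, ← hck, mul_inv_eq_iff_eq_mul, mul_assoc,
        eq_inv_mul_iff_mul_eq]
    have h₂ : cs.simple j * (c ^ n * p.1 * (c ^ n)⁻¹) * cs.simple j = cs.simple i ↔
        p.1 = cs.simple j * c ^ (2 * n + 1) := by
      have hi : cs.simple i = c * cs.simple j := by simp [hc]
      have e : cs.simple j * c ^ (2 * n + 1) =
          (c ^ n)⁻¹ * (cs.simple j * cs.simple i * cs.simple j) * c ^ n := by
        rw [show 2 * n + 1 = n + (1 + n) by ring, pow_add, ← mul_assoc, ← hck, pow_add, pow_one,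
          hc]
        simp only [mul_assoc]
      rw [e]
      constructor
      · intro h
        rw [← h]
        simp [mul_assoc]
      · intro h
        rw [h]
        simp [mul_assoc]
    simp only [signedConj, h₁, h₂]
    refine Prod.ext ?_ ?_
    · simp only [pow_succ', mul_inv_rev, hc, inv_simple]
      simp only [mul_assoc]
    · simp only [add_assoc]

theorem isLiftable_signedConj (cs : CoxeterSystem M W) : M.IsLiftable (signedConj cs) := by
  intro i j
  funext p
  rw [signedConj_mul_pow_apply, cs.simple_mul_simple_pow, two_mul, Finset.sum_range_add]
  simp only [pow_add, cs.simple_mul_simple_pow, one_mul, CharTwo.add_self_eq_zero]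
  simp [Function.End.one_def]

/-- The action of the Coxeter group on `W × ℤ/2` extending `signedConj`. -/
noncomputable def signedConjHom (cs : CoxeterSystem M W) : W →* Function.End (W × ZMod 2) :=
  cs.lift ⟨signedConj cs, isLiftable_signedConj cs⟩

theorem signedConjHom_simple (cs : CoxeterSystem M W) (i : B) :
    signedConjHom cs (cs.simple i) = signedConj cs i :=
  cs.lift_apply_simple (isLiftable_signedConj cs) i

theorem signedConjHom_mul_apply (cs : CoxeterSystem M W) (x y : W) (p : W × ZMod 2) :
    signedConjHom cs (x * y) p = signedConjHom cs x (signedConjHom cs y p) := by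
  rw [map_mul]; rfl

theorem signedConjHom_wordProd_apply (cs : CoxeterSystem M W) (ω : List B) (p : W × ZMod 2) :
    signedConjHom cs (cs.wordProd ω) p =
      (cs.wordProd ω * p.1 * (cs.wordProd ω)⁻¹,
        p.2 + ((cs.rightInvSeq ω).map fun r => if p.1 = r then 1 else 0).sum) := by
  induction ω with
  | nil => simp only [wordProd_nil, map_one]; simp [Function.End.one_def]
  | cons i ω ih =>
    have h : cs.wordProd ω * p.1 * (cs.wordProd ω)⁻¹ = cs.simple i ↔
        p.1 = (cs.wordProd ω)⁻¹ * cs.simple i * cs.wordProd ω := by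
      rw [mul_inv_eq_iff_eq_mul, mul_assoc, eq_inv_mul_iff_mul_eq]
    rw [wordProd_cons, signedConjHom_mul_apply, ih, signedConjHom_simple]
    simp only [signedConj, h, rightInvSeq, List.map_cons, List.sum_cons]
    refine Prod.ext ?_ ?_
    · simp [mul_assoc]
    · simp only; ring

theorem mem_rightInvSeq_of_signedConjHom_ne (cs : CoxeterSystem M W) (ω : List B) (t : W)
    (h : (signedConjHom cs (cs.wordProd ω) (t, 0)).2 ≠ 0) : t ∈ cs.rightInvSeq ω := by
  contrapose! h
  rw [signedConjHom_wordProd_apply]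
  simp only [zero_add]
  refine List.sum_eq_zero fun x hx => ?_
  obtain ⟨r, hr, rfl⟩ := List.mem_map.1 hx
  exact if_neg fun e : t = r => h (e ▸ hr)

/-- A right descent of a group element occurs in the right inversion sequence of every word
representing it. -/
theorem simple_mem_rightInvSeq (cs : CoxeterSystem M W) (ω : List B) (i : B)
    (hi : cs.IsRightDescent (cs.wordProd ω) i) : cs.simple i ∈ cs.rightInvSeq ω := by
  obtain ⟨ω', hω', he⟩ := cs.exists_isReduced (cs.wordProd ω * cs.simple i)
  have hnot : cs.simple i ∉ cs.rightInvSeq ω' := by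
    intro hmem
    have h := (cs.isRightInversion_of_mem_rightInvSeq hω' hmem).2
    rw [← he, cs.simple_mul_simple_cancel_right] at h
    exact absurd hi (not_lt.2 h.le)
  have hfix : (signedConjHom cs (cs.wordProd ω') (cs.simple i, 0)).2 = 0 := by
    by_contra h
    exact hnot (mem_rightInvSeq_of_signedConjHom_ne cs ω' _ h)
  apply mem_rightInvSeq_of_signedConjHom_ne
  have hw : cs.wordProd ω = cs.wordProd ω' * cs.simple i := by
    rw [← he, cs.simple_mul_simple_cancel_right]
  rw [signedConjHom_wordProd_apply] at hfix
  rw [hw, signedConjHom_mul_apply, signedConjHom_simple, signedConjHom_wordProd_apply]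
  simp only [zero_add] at hfix
  simp [signedConj, hfix]

/-- The exchange condition. -/
theorem exists_wordProd_mul_simple_eq_eraseIdx (cs : CoxeterSystem M W) (ω : List B) (i : B)
    (hi : cs.IsRightDescent (cs.wordProd ω) i) :
    ∃ j < ω.length, cs.wordProd ω * cs.simple i = cs.wordProd (ω.eraseIdx j) := by
  obtain ⟨j, hj, he⟩ := List.mem_iff_getElem.1 (simple_mem_rightInvSeq cs ω i hi)
  refine ⟨j, by simpa using hj, ?_⟩
  rw [← cs.wordProd_mul_getD_rightInvSeq, List.getD_eq_getElem _ _ hj, he]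

/-- Every word has a reduced word with the same product and no new letters. -/
theorem exists_isReduced_subset (cs : CoxeterSystem M W) (ω : List B) :
    ∃ ω', cs.IsReduced ω' ∧ ω' ⊆ ω ∧ cs.wordProd ω' = cs.wordProd ω := by
  induction ω using List.reverseRecOn with
  | nil => exact ⟨[], by simp [CoxeterSystem.IsReduced], by simp, rfl⟩
  | append_singleton ω i ih =>
    obtain ⟨ω', hred, hsub, hprod⟩ := ih
    by_cases hi : cs.IsRightDescent (cs.wordProd ω') i
    · obtain ⟨j, hj, he⟩ := exists_wordProd_mul_simple_eq_eraseIdx cs ω' i hi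
      refine ⟨ω'.eraseIdx j, ?_, ?_, ?_⟩
      · have h₁ := cs.isRightDescent_iff.1 hi
        have h₂ := List.length_eraseIdx_add_one hj
        rw [he, hred.eq] at h₁
        unfold CoxeterSystem.IsReduced
        omega
      · exact fun x hx => List.mem_append_left _ (hsub (List.mem_of_mem_eraseIdx hx))
      · rw [← he, wordProd_append, hprod, wordProd_singleton]
    · refine ⟨ω' ++ [i], ?_, ?_, ?_⟩
      · have h := cs.not_isRightDescent_iff.1 hi
        rw [hred.eq] at h
        simpa [CoxeterSystem.IsReduced, wordProd_append] using h
      · exact List.append_subset.2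
          ⟨fun x hx => List.mem_append_left _ (hsub hx), List.subset_append_right _ _⟩
      · simp [wordProd_append, hprod]

theorem exists_wordProd_eq_of_mem_closure (cs : CoxeterSystem M W) (T : Set B) {y : W}
    (hy : y ∈ Subgroup.closure (cs.simple '' T)) :
    ∃ ω : List B, (∀ i ∈ ω, i ∈ T) ∧ cs.wordProd ω = y := by
  induction hy using Subgroup.closure_induction with
  | mem x hx =>
    obtain ⟨i, hi, rfl⟩ := hx
    exact ⟨[i], by simpa using hi, by simp⟩
  | one => exact ⟨[], by simp, by simp⟩
  | mul x y _ _ hx hy =>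
    obtain ⟨ω₁, h₁, rfl⟩ := hx
    obtain ⟨ω₂, h₂, rfl⟩ := hy
    exact ⟨ω₁ ++ ω₂, fun i hi => (List.mem_append.1 hi).elim (h₁ i) (h₂ i),
      cs.wordProd_append ω₁ ω₂⟩
  | inv x _ hx =>
    obtain ⟨ω, h, rfl⟩ := hx
    exact ⟨ω.reverse, fun i hi => h i (List.mem_reverse.1 hi), cs.wordProd_reverse ω⟩

/-- A reduced word all of whose letters are right descents of `g` is a suffix of a reduced word
for `g`. -/
theorem exists_isReduced_append (cs : CoxeterSystem M W) (g : W) (ω : List B)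
    (hω : cs.IsReduced ω) (hdesc : ∀ i ∈ ω, cs.IsRightDescent g i) :
    ∃ α : List B, cs.IsReduced (α ++ ω) ∧ cs.wordProd (α ++ ω) = g := by
  induction ω using List.reverseRecOn with
  | nil =>
    obtain ⟨α, hα, rfl⟩ := cs.exists_isReduced g
    exact ⟨α, by simpa using hα, by simp⟩
  | append_singleton ω i ih =>
    have hω' : cs.IsReduced ω := by simpa using hω.take ω.length
    obtain ⟨α, hred, hprod⟩ := ih hω' fun j hj => hdesc j (List.mem_append_left _ hj)
    have hi : cs.IsRightDescent (cs.wordProd (α ++ ω)) i := hprod ▸ hdesc i (by simp)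
    obtain ⟨j, hj, he⟩ := exists_wordProd_mul_simple_eq_eraseIdx cs (α ++ ω) i hi
    rcases lt_or_ge j α.length with hjα | hjα
    · rw [List.eraseIdx_append_of_lt_length hjα] at he
      have hg : cs.wordProd (α.eraseIdx j ++ (ω ++ [i])) = g := by
        rw [← List.append_assoc, wordProd_append, ← he, wordProd_singleton,
          cs.simple_mul_simple_cancel_right, hprod]
      refine ⟨α.eraseIdx j, ?_, hg⟩
      have h₁ := hred.eq
      have h₂ := List.length_eraseIdx_add_one hjα
      rw [hprod] at h₁
      unfold CoxeterSystem.IsReduced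
      rw [hg, h₁]
      simp only [List.length_append, List.length_singleton]
      omega
    · rw [List.eraseIdx_append_of_length_le hjα, wordProd_append, wordProd_append, mul_assoc,
        mul_right_inj] at he
      have h₁ := hω.eq
      have h₂ := cs.length_wordProd_le (ω.eraseIdx (j - α.length))
      have h₃ := List.length_eraseIdx_le ω (j - α.length)
      rw [wordProd_append, wordProd_singleton, he] at h₁
      simp only [List.length_append, List.length_singleton] at h₁
      omega

/-- Multiplying `g` by the inverse of an element of `⟨T(g)⟩` subtracts lengths. -/
theorem length_mul_inv_add_length (cs : CoxeterSystem M W) {g y : W}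
    (hy : y ∈ descSubgroup cs g) :
    cs.length (g * y⁻¹) + cs.length y = cs.length g := by
  obtain ⟨ω₀, hω₀, rfl⟩ := exists_wordProd_eq_of_mem_closure cs _ hy
  obtain ⟨ω, hred, hsub, hprod⟩ := exists_isReduced_subset cs ω₀
  obtain ⟨α, hα, rfl⟩ := exists_isReduced_append cs g ω hred fun i hi => hω₀ i (hsub hi)
  have hα' : cs.IsReduced α := by simpa using hα.take α.length
  rw [hα.eq, ← hprod, hred.eq, wordProd_append, mul_inv_cancel_right, hα'.eq,
    List.length_append]

theorem wg_mem_descSubgroup (cs : CoxeterSystem M W) (g : W) : wg cs g ∈ descSubgroup cs g := by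
  unfold wg
  split_ifs with h
  · exact h.choose_spec.1
  · exact one_mem _

end Exchange

/-- The standard language is geodesic: every word of `𝓛` has length equal to the word length
of the element it represents. -/
theorem standard_language_geodesic (cs : CoxeterSystem M W)
    (v : List B) (hv : StdLang cs v) :
    v.length = cs.length (cs.wordProd v) := by
  induction hv with
  | nil => simp
  | step v _ _ hsuf ih =>
    have hsplit : cs.wordProd (v.take (v.length - cs.length (wg cs (cs.wordProd v)))) =
        cs.wordProd v * (wg cs (cs.wordProd v))⁻¹ := by
      rw [eq_mul_inv_iff_mul_eq]
      nth_rw 2 [← hsuf]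
      rw [← wordProd_append, List.take_append_drop]
    have hadd := length_mul_inv_add_length cs (wg_mem_descSubgroup cs (cs.wordProd v))
    have hle := cs.length_wordProd_le v
    rw [hsplit, List.length_take] at ih
    omega

end CoxeterPaper
end

section
/- Let W be a Coxeter group, let g ∈ W, and let R = g⟨T(g)⟩ be the T(g)-residue containing g. Then every wall that intersects R (i.e., separates some two elements of R) belongs to 𝓦(g). -/
namespace CoxeterPaper

open CoxeterSystem

attribute [local instance] Classical.propDecidable

variable {B : Type} [DecidableEq B] [Fintype B]
variable {W : Type} [Group W] {M : CoxeterMatrix B}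

/-- The action of the simple reflection `i` on `W × ℤ/2`: conjugate the first coordinate, and flip
the second one exactly at `s i`. -/
noncomputable def simpleSignedConj (cs : CoxeterSystem M W) (i : B) :
    Function.End (W × ZMod 2) :=
  fun p ↦ (cs.simple i * p.1 * cs.simple i, p.2 + if p.1 = cs.simple i then 1 else 0)

lemma end_mul_apply {α : Type*} (f g : Function.End α) (x : α) : (f * g) x = f (g x) := rfl

lemma simpleSignedConj_mul_pow (cs : CoxeterSystem M W) (i j : B) (k : ℕ) (t : W) (e : ZMod 2) :
    ((simpleSignedConj cs i * simpleSignedConj cs j) ^ k) (t, e) =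
      ((cs.simple i * cs.simple j) ^ k * t * ((cs.simple i * cs.simple j) ^ k)⁻¹,
        e + ∑ l ∈ Finset.range (2 * k),
          if t = ((cs.simple i * cs.simple j) ^ l)⁻¹ * cs.simple j then 1 else 0) := by
  induction k with
  | zero => simp [Function.End.one_def]
  | succ k ih =>
    have hcomm (n : ℕ) : cs.simple j * (cs.simple i * cs.simple j) ^ n =
        ((cs.simple i * cs.simple j) ^ n)⁻¹ * cs.simple j := by
      rw [← mul_inv_eq_iff_eq_mul, ← conj_pow, ← inv_pow]
      congr 1
      simp [mul_assoc]
    have h1 : (cs.simple i * cs.simple j) ^ k * t * ((cs.simple i * cs.simple j) ^ k)⁻¹ =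
        cs.simple j ↔ t = ((cs.simple i * cs.simple j) ^ (2 * k))⁻¹ * cs.simple j := by
      rw [mul_inv_eq_iff_eq_mul, hcomm, two_mul, pow_add, mul_inv_rev, mul_assoc,
        ← eq_inv_mul_iff_mul_eq]
    have h2 : cs.simple j * ((cs.simple i * cs.simple j) ^ k * t *
        ((cs.simple i * cs.simple j) ^ k)⁻¹) * cs.simple j = cs.simple i ↔
        t = ((cs.simple i * cs.simple j) ^ (2 * k + 1))⁻¹ * cs.simple j := by
      have hj : cs.simple j * cs.simple i * cs.simple j =
          (cs.simple i * cs.simple j)⁻¹ * cs.simple j := by simp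
      rw [← eq_mul_inv_iff_mul_eq, ← eq_inv_mul_iff_mul_eq, cs.inv_simple, ← mul_assoc, hj,
        mul_inv_eq_iff_eq_mul, mul_assoc _ (cs.simple j), hcomm, ← eq_inv_mul_iff_mul_eq,
        show 2 * k + 1 = k + 1 + k by ring, pow_add, pow_succ]
      simp only [mul_inv_rev, mul_assoc]
    rw [pow_succ', end_mul_apply, ih, end_mul_apply, show 2 * (k + 1) = 2 * k + 1 + 1 by ring,
      Finset.sum_range_succ, Finset.sum_range_succ]
    simp only [simpleSignedConj, h1, h2, ← add_assoc]
    rw [pow_succ' _ k, mul_inv_rev, mul_inv_rev, cs.inv_simple, cs.inv_simple]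
    simp only [mul_assoc]

lemma isLiftable_simpleSignedConj (cs : CoxeterSystem M W) :
    M.IsLiftable (simpleSignedConj cs) := by
  intro i j
  funext ⟨t, e⟩
  rw [simpleSignedConj_mul_pow, cs.simple_mul_simple_pow, two_mul, Finset.sum_range_add]
  simp only [pow_add, cs.simple_mul_simple_pow, one_mul, CharTwo.add_self_eq_zero]
  simp [Function.End.one_def]

/-- The parity of the number of times a gallery of type `w` crosses the wall of `t`: it is `1`
exactly when `t` is a right inversion of `w`. -/
noncomputable def invParity (cs : CoxeterSystem M W) (w t : W) : ZMod 2 :=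
  (cs.lift ⟨simpleSignedConj cs, isLiftable_simpleSignedConj cs⟩ w (t, 0)).2

lemma lift_simpleSignedConj_apply (cs : CoxeterSystem M W) (w t : W) (e : ZMod 2) :
    cs.lift ⟨simpleSignedConj cs, isLiftable_simpleSignedConj cs⟩ w (t, e) =
      (w * t * w⁻¹, e + invParity cs w t) := by
  unfold invParity
  induction w using cs.simple_induction_left generalizing t e with
  | one => simp [Function.End.one_def]
  | mul_simple_left w i ih =>
    rw [map_mul, end_mul_apply, end_mul_apply, ih, ih t 0,
      cs.lift_apply_simple]
    simp [simpleSignedConj, mul_assoc, add_assoc]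

lemma invParity_mul (cs : CoxeterSystem M W) (v w t : W) :
    invParity cs (v * w) t = invParity cs w t + invParity cs v (w * t * w⁻¹) := by
  conv_lhs => rw [invParity]
  rw [map_mul, end_mul_apply, lift_simpleSignedConj_apply,
    lift_simpleSignedConj_apply, zero_add]

lemma invParity_one (cs : CoxeterSystem M W) (t : W) : invParity cs 1 t = 0 := by
  simp [invParity, Function.End.one_def]

lemma invParity_simple (cs : CoxeterSystem M W) (i : B) (t : W) :
    invParity cs (cs.simple i) t = if t = cs.simple i then 1 else 0 := by
  simp [invParity, simpleSignedConj, cs.lift_apply_simple]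

lemma zmod_two_ne_zero_iff {x : ZMod 2} : x ≠ 0 ↔ x = 1 := by
  revert x; decide

lemma zmod_two_add_eq_zero_iff {x y : ZMod 2} : x + y = 0 ↔ x = y := by
  revert x y; decide

lemma invParity_inv (cs : CoxeterSystem M W) (w t : W) :
    invParity cs w⁻¹ t = invParity cs w (w⁻¹ * t * w) := by
  have h := invParity_mul cs w w⁻¹ t
  rw [mul_inv_cancel, invParity_one, inv_inv] at h
  exact zmod_two_add_eq_zero_iff.1 h.symm

lemma mem_rightInvSeq_of_invParity_ne_zero (cs : CoxeterSystem M W) (ω : List B) {t : W}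
    (h : invParity cs (cs.wordProd ω) t ≠ 0) : t ∈ cs.rightInvSeq ω := by
  induction ω with
  | nil => simp [invParity_one] at h
  | cons i ω ih =>
    rw [CoxeterSystem.rightInvSeq, List.mem_cons]
    by_cases h' : invParity cs (cs.wordProd ω) t = 0
    · rw [cs.wordProd_cons, invParity_mul, h', zero_add, invParity_simple] at h
      left
      have : cs.wordProd ω * t * (cs.wordProd ω)⁻¹ = cs.simple i := by
        by_contra hne
        simp [hne] at h
      rw [← this]
      group
    · exact Or.inr (ih h')

lemma length_mul_lt_of_invParity_eq_one (cs : CoxeterSystem M W) {w t : W}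
    (h : invParity cs w t = 1) : cs.length (w * t) < cs.length w := by
  obtain ⟨ω, hω, rfl⟩ := cs.exists_isReduced w
  exact (cs.isRightInversion_of_mem_rightInvSeq hω
    (mem_rightInvSeq_of_invParity_ne_zero cs ω (by simp [h]))).2

lemma invParity_self (cs : CoxeterSystem M W) {t : W} (ht : cs.IsReflection t) :
    invParity cs t t = 1 := by
  obtain ⟨u, i, rfl⟩ := ht
  have hu := invParity_inv cs u (u * cs.simple i * u⁻¹)
  have h1 : u⁻¹ * (u * cs.simple i * u⁻¹) * u = cs.simple i := by group
  rw [h1] at hu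
  rw [invParity_mul, invParity_mul, inv_inv, h1, hu, invParity_simple, if_pos rfl]
  simp only [cs.inv_simple, cs.simple_mul_simple_self, one_mul]
  rw [add_left_comm, CharTwo.add_self_eq_zero, add_zero]

/-- The strong exchange property, in terms of `invParity`. -/
lemma invParity_eq_one_iff (cs : CoxeterSystem M W) {t : W} (ht : cs.IsReflection t) (w : W) :
    invParity cs w t = 1 ↔ cs.length (w * t) < cs.length w := by
  refine ⟨length_mul_lt_of_invParity_eq_one cs, fun h ↦ ?_⟩
  by_contra h0
  have h1 : invParity cs (w * t) t = 1 := by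
    rw [invParity_mul, invParity_self cs ht, mul_inv_cancel_right,
      not_not.1 (mt zmod_two_ne_zero_iff.1 h0), add_zero]
  have h2 := length_mul_lt_of_invParity_eq_one cs h1
  rw [mul_assoc, ht.mul_self, mul_one] at h2
  exact h.asymm h2

lemma length_mul_lt_left_iff (cs : CoxeterSystem M W) {ρ : W} (hρ : cs.IsReflection ρ) (a : W) :
    cs.length (ρ * a) < cs.length a ↔ invParity cs a⁻¹ ρ = 1 := by
  rw [invParity_eq_one_iff cs hρ, ← cs.length_inv (ρ * a), mul_inv_rev, hρ.inv, cs.length_inv a]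

lemma separates_iff (cs : CoxeterSystem M W) {ρ : W} (hρ : cs.IsReflection ρ) (a b : W) :
    Separates cs ρ a b ↔ invParity cs a⁻¹ ρ ≠ invParity cs b⁻¹ ρ := by
  rw [Separates, length_mul_lt_left_iff cs hρ, length_mul_lt_left_iff cs hρ]
  generalize invParity cs a⁻¹ ρ = x
  generalize invParity cs b⁻¹ ρ = y
  revert x y
  unfold Xor'
  decide

/-- Inversions of an element of a standard parabolic subgroup are reflections of that subgroup. -/
lemma exists_conj_of_invParity_ne_zero (cs : CoxeterSystem M W) {T : Set B} {x t : W}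
    (hx : x ∈ Subgroup.closure (cs.simple '' T)) (h : invParity cs x t ≠ 0) :
    ∃ u ∈ Subgroup.closure (cs.simple '' T), ∃ i ∈ T, t = u * cs.simple i * u⁻¹ := by
  induction hx using Subgroup.closure_induction generalizing t with
  | mem x hx =>
    obtain ⟨i, hi, rfl⟩ := hx
    refine ⟨1, one_mem _, i, hi, ?_⟩
    by_contra hne
    simp [invParity_simple] at h hne
    exact hne h
  | one => simp [invParity_one] at h
  | mul x y hx hy ihx ihy =>
    by_cases h' : invParity cs y t = 0
    · rw [invParity_mul, h', zero_add] at h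
      obtain ⟨u, hu, i, hi, hui⟩ := ihx h
      refine ⟨y⁻¹ * u, mul_mem (inv_mem hy) hu, i, hi, ?_⟩
      have : t = y⁻¹ * (y * t * y⁻¹) * y := by group
      rw [this, hui]
      group
    · exact ihy h'
  | inv x hx ih =>
    rw [invParity_inv] at h
    obtain ⟨u, hu, i, hi, hui⟩ := ih h
    refine ⟨x * u, mul_mem hx hu, i, hi, ?_⟩
    have : t = x * (x⁻¹ * t * x) * x⁻¹ := by group
    rw [this, hui]
    group

/-- One step up in the Bruhat order. -/
def BruhatStep (cs : CoxeterSystem M W) (a b : W) : Prop :=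
  ∃ t, cs.IsReflection t ∧ b = a * t ∧ cs.length a < cs.length b

lemma BruhatStep.eq_or_mul_simple {cs : CoxeterSystem M W} {a b : W} (h : BruhatStep cs a b)
    (i : B) : b = a * cs.simple i ∨ BruhatStep cs (a * cs.simple i) (b * cs.simple i) := by
  obtain ⟨t, ht, rfl, hlt⟩ := h
  by_cases hti : t = cs.simple i
  · exact Or.inl (by rw [hti])
  have hconj : cs.IsReflection (cs.simple i * t * cs.simple i) := by
    simpa using ht.conj (cs.simple i)
  have heq : a * t * cs.simple i = a * cs.simple i * (cs.simple i * t * cs.simple i) := by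
    simp [mul_assoc]
  refine Or.inr ⟨_, hconj, heq, ?_⟩
  have h0 : invParity cs a t ≠ 1 := by
    rw [Ne, invParity_eq_one_iff cs ht]
    exact hlt.asymm
  have hne : cs.simple i * t * cs.simple i ≠ cs.simple i := by
    intro h
    apply hti
    have := congrArg (fun x ↦ cs.simple i * x * cs.simple i) h
    simpa [mul_assoc] using this
  have h1 : invParity cs (a * cs.simple i) (cs.simple i * t * cs.simple i) ≠ 1 := by
    rw [invParity_mul, invParity_simple, if_neg hne, zero_add]
    simpa [mul_assoc] using h0
  rw [Ne, invParity_eq_one_iff cs hconj, ← heq, not_lt] at h1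
  refine lt_of_le_of_ne h1 fun h ↦ ?_
  exact hconj.length_mul_left_ne (a * cs.simple i) (by rw [← heq, h])

/-- The lifting property of the Bruhat order. -/
lemma bruhat_mul_simple_of_isRightDescent {cs : CoxeterSystem M W} {a v : W}
    (h : Relation.ReflTransGen (BruhatStep cs) a v) {i : B} (hi : cs.IsRightDescent v i) :
    Relation.ReflTransGen (BruhatStep cs) (a * cs.simple i) v := by
  induction h using Relation.ReflTransGen.head_induction_on with
  | refl =>
    exact .single ⟨cs.simple i, cs.isReflection_simple i, by simp [mul_assoc], hi⟩
  | head hab hbv ih =>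
    rcases hab.eq_or_mul_simple i with rfl | hstep
    · exact hbv
    · exact ih.head hstep

lemma length_mul_le_of_mem_descSubgroup (cs : CoxeterSystem M W) {g x : W}
    (hx : x ∈ descSubgroup cs g) : cs.length (g * x) ≤ cs.length g := by
  have hchain : Relation.ReflTransGen (BruhatStep cs) (g * x) g := by
    unfold descSubgroup at hx
    induction hx using Subgroup.closure_induction_right with
    | one => rw [mul_one]
    | mul_right x hx y hy ih =>
      obtain ⟨i, hi, rfl⟩ := hy
      rw [← mul_assoc]
      exact bruhat_mul_simple_of_isRightDescent ih hi
    | mul_inv_cancel x hx y hy ih =>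
      obtain ⟨i, hi, rfl⟩ := hy
      rw [← mul_assoc, cs.inv_simple]
      exact bruhat_mul_simple_of_isRightDescent ih hi
  generalize g * x = y at hchain
  induction hchain using Relation.ReflTransGen.head_induction_on with
  | refl => rfl
  | head hab _ ih =>
    obtain ⟨_, _, _, hlt⟩ := hab
    exact hlt.le.trans ih

lemma invParity_eq_one_of_mem_descSubgroup (cs : CoxeterSystem M W) {g t : W}
    (ht : cs.IsReflection t) (htm : t ∈ descSubgroup cs g) : invParity cs g t = 1 :=
  (invParity_eq_one_iff cs ht g).2
    (lt_of_le_of_ne (length_mul_le_of_mem_descSubgroup cs htm) (ht.length_mul_left_ne g))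

/-- The subgroup `⟨T(g)⟩` has an element inverting all its reflections. -/
lemma exists_invParity_eq_one (cs : CoxeterSystem M W) (g : W) :
    ∃ w ∈ descSubgroup cs g, ∀ t ∈ descSubgroup cs g, cs.IsReflection t →
      invParity cs w t = 1 := by
  obtain ⟨x, hx, hmin⟩ := exists_minimalFor_of_wellFoundedLT (· ∈ descSubgroup cs g)
    (fun x ↦ cs.length (g * x)) ⟨1, one_mem _⟩
  refine ⟨x⁻¹, inv_mem hx, fun t ht hrefl ↦ ?_⟩
  have hg := invParity_eq_one_of_mem_descSubgroup cs hrefl ht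
  have hconj : cs.IsReflection (x⁻¹ * t * x) := by simpa using hrefl.conj x⁻¹
  have hd : invParity cs (g * x) (x⁻¹ * t * x) ≠ 1 := by
    rw [Ne, invParity_eq_one_iff cs hconj]
    intro hlt
    have hmem : x * (x⁻¹ * t * x) ∈ descSubgroup cs g :=
      mul_mem hx (mul_mem (mul_mem (inv_mem hx) ht) hx)
    rw [mul_assoc] at hlt
    exact hlt.not_ge (hmin hmem hlt.le)
  have hsplit := invParity_mul cs (g * x) x⁻¹ t
  rw [mul_inv_cancel_right, inv_inv, hg,
    not_not.1 (mt zmod_two_ne_zero_iff.1 hd), add_zero] at hsplit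
  exact hsplit.symm

/-- An element inverting all reflections of a standard parabolic subgroup permutes its simple
reflections by conjugation. -/
lemma exists_conj_simple_eq_simple (cs : CoxeterSystem M W) {T : Set B} {w : W}
    (hw : w ∈ Subgroup.closure (cs.simple '' T))
    (hinv : ∀ t ∈ Subgroup.closure (cs.simple '' T), cs.IsReflection t → invParity cs w t = 1)
    {i : B} (hi : i ∈ T) : ∃ j, w * cs.simple i * w⁻¹ = cs.simple j := by
  have hiT : cs.simple i ∈ Subgroup.closure (cs.simple '' T) :=
    Subgroup.subset_closure ⟨i, hi, rfl⟩
  have hxT := mul_mem (mul_mem hw hiT) (inv_mem hw)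
  have hx1 : w * cs.simple i * w⁻¹ ≠ 1 := by
    rw [Ne, conj_eq_one_iff]
    intro h
    simpa [h] using cs.length_simple i
  obtain ⟨j, hj⟩ := cs.exists_rightDescent_of_ne_one hx1
  have hn := (invParity_eq_one_iff cs (cs.isReflection_simple j) _).2 hj
  obtain ⟨u, hu, k, hk, huk⟩ := exists_conj_of_invParity_ne_zero cs hxT (zmod_two_ne_zero_iff.2 hn)
  have hjT : cs.simple j ∈ Subgroup.closure (cs.simple '' T) := by
    rw [huk]
    exact mul_mem (mul_mem hu (Subgroup.subset_closure ⟨k, hk, rfl⟩)) (inv_mem hu)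
  set t := w⁻¹ * cs.simple j * w with ht
  have htT : t ∈ Subgroup.closure (cs.simple '' T) := mul_mem (mul_mem (inv_mem hw) hjT) hw
  have htr : cs.IsReflection t := by simpa using (cs.isReflection_simple j).conj w⁻¹
  have h1 := hinv t htT htr
  have h2 : invParity cs w (cs.simple i * t * cs.simple i) = 1 :=
    hinv _ (mul_mem (mul_mem hiT htT) hiT) (by simpa using htr.conj (cs.simple i))
  rw [invParity_mul, invParity_mul, invParity_inv, inv_inv, ← ht, h1, cs.inv_simple, h2,
    invParity_simple] at hn
  refine ⟨j, ?_⟩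
  have hti : t = cs.simple i := by
    by_contra hne
    rw [if_neg hne] at hn
    revert hn
    decide
  rw [← hti, ht]
  group

/-- A wall separating two elements of the `T(g)`-residue of `g` is the wall of a reflection
conjugated into it. -/
lemma exists_conj_of_separates (cs : CoxeterSystem M W) {g ρ a b : W} (hρ : cs.IsReflection ρ)
    (ha : g⁻¹ * a ∈ descSubgroup cs g) (hb : g⁻¹ * b ∈ descSubgroup cs g)
    (h : Separates cs ρ a b) :
    ∃ u ∈ descSubgroup cs g, ∃ i ∈ descentSet cs g, g⁻¹ * ρ * g = u * cs.simple i * u⁻¹ := by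
  rw [separates_iff cs hρ] at h
  have hsplit (c : W) : invParity cs c⁻¹ ρ =
      invParity cs g⁻¹ ρ + invParity cs (g⁻¹ * c)⁻¹ (g⁻¹ * ρ * g) := by
    have := invParity_mul cs (g⁻¹ * c)⁻¹ g⁻¹ ρ
    rwa [← mul_inv_rev, mul_inv_cancel_left, inv_inv] at this
  rw [hsplit a, hsplit b] at h
  by_cases h0 : invParity cs (g⁻¹ * a)⁻¹ (g⁻¹ * ρ * g) = 0
  · refine exists_conj_of_invParity_ne_zero cs (inv_mem hb) fun h1 ↦ h ?_
    rw [h0, h1]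
  · exact exists_conj_of_invParity_ne_zero cs (inv_mem ha) h0

/-- **Remark.** Every wall intersecting the `T(g)`-residue of `g` belongs to `𝓦(g)`. -/
theorem walls_of_residue_near (cs : CoxeterSystem M W) (g : W) :
    ∀ ρ : W, cs.IsReflection ρ →
      (∃ a b : W, g⁻¹ * a ∈ descSubgroup cs g ∧ g⁻¹ * b ∈ descSubgroup cs g ∧
        Separates cs ρ a b) →
      ρ ∈ WallsNear cs g := by
  intro ρ hρ ⟨a, b, ha, hb, hab⟩
  obtain ⟨u, hu, i, hi, hui⟩ := exists_conj_of_separates cs hρ ha hb hab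
  have hiT : cs.simple i ∈ descSubgroup cs g := Subgroup.subset_closure ⟨i, hi, rfl⟩
  have hρ_eq : ρ = g * u * cs.simple i * (g * u)⁻¹ := by
    have : ρ = g * (g⁻¹ * ρ * g) * g⁻¹ := by group
    rw [this, hui]
    group
  refine ⟨hρ, ?_, fun ρ' hρ' _ hsep ↦ ?_⟩
  · have h := length_mul_le_of_mem_descSubgroup cs (mul_mem (mul_mem hu hiT) (inv_mem hu))
    rw [← hui, mul_assoc, mul_inv_cancel_left] at h
    exact lt_of_le_of_ne h (hρ.length_mul_right_ne g)
  · obtain ⟨w, hw, hinv⟩ := exists_invParity_eq_one cs g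
    obtain ⟨j, hj⟩ := exists_conj_simple_eq_simple cs hw hinv hi
    have hadj : AdjacentWall cs ρ (g * u) := ⟨i, hρ_eq⟩
    have hadj' : AdjacentWall cs ρ (g * u * w⁻¹) := by
      refine ⟨j, ?_⟩
      rw [← hj, hρ_eq]
      group
    have h1 := hsep _ hadj
    obtain ⟨v, hv, k, hk, hvk⟩ := exists_conj_of_separates cs hρ'
      (by rw [inv_mul_cancel]; exact one_mem _) (by rwa [inv_mul_cancel_left]) h1
    have hkT : cs.simple k ∈ descSubgroup cs g := Subgroup.subset_closure ⟨k, hk, rfl⟩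
    have hmem : (g * u)⁻¹ * ρ' * (g * u) ∈ descSubgroup cs g := by
      have : (g * u)⁻¹ * ρ' * (g * u) = u⁻¹ * (g⁻¹ * ρ' * g) * u := by group
      rw [this, hvk]
      exact mul_mem (mul_mem (inv_mem hu) (mul_mem (mul_mem hv hkT) (inv_mem hv))) hu
    have hflip := hinv _ hmem (by simpa using hρ'.conj (g * u)⁻¹)
    have h2 := hsep _ hadj'
    rw [separates_iff cs hρ'] at h1 h2
    rw [mul_inv_rev, inv_inv, invParity_mul, inv_inv, hflip] at h2
    revert h1 h2
    generalize invParity cs g⁻¹ ρ' = x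
    generalize invParity cs (g * u)⁻¹ ρ' = y
    revert x y
    decide

end CoxeterPaper
end
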